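/- Let d ≥ 0. For every n × m matrix P over 𝔽₂ there exists an n × m' matrix P' over 𝔽₂ with m' ≤ Σ_{i=0}^{d} C(n,i) such that for all d+1 indices α₁ ≤ ⋯ ≤ α_{d+1}, |P'_{α₁} ∧ ⋯ ∧ P'_{α_{d+1}}| ≡ |P_{α₁} ∧ ⋯ ∧ P_{α_{d+1}}| (mod 2). -/

import Mathlib

lemma zmod2_pow (y : ZMod 2) (k : ℕ) (hk : k ≠ 0) : y ^ k = y := by
  have h : ∀ y : ZMod 2, y = 0 ∨ y = 1 := by decide
  rcases h y with h | h <;> simp [h, hk]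

/-- If there are more columns than low-degree monomials, a nonzero `y` is orthogonal to all of
the low-degree products of rows. -/
lemma exists_y (d n m : ℕ) (P : Fin n → Fin m → ZMod 2)
    (hm : ∑ i ∈ Finset.range (d + 1), n.choose i < m) :
    ∃ y : Fin m → ZMod 2, y ≠ 0 ∧ ∀ T : Finset (Fin n), T.card ≤ d →
      ∑ i, y i * ∏ a ∈ T, P a i = 0 := by
  classical
  let I : Finset (Finset (Fin n)) :=
    (Finset.range (d + 1)).biUnion (fun i => Finset.powersetCard i Finset.univ)
  have hI : I.card ≤ ∑ i ∈ Finset.range (d + 1), n.choose i := by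
    refine Finset.card_biUnion_le.trans ?_
    simp
  let M : Matrix I (Fin m) (ZMod 2) := fun T i => ∏ a ∈ T.1, P a i
  have hker : LinearMap.ker (Matrix.mulVecLin M) ≠ ⊥ := by
    apply LinearMap.ker_ne_bot_of_finrank_lt
    simp
    omega
  obtain ⟨y, hy, hy0⟩ := (Submodule.ne_bot_iff _).1 hker
  refine ⟨y, hy0, fun T hT => ?_⟩
  have hTI : T ∈ I := by
    simp [I]
    omega
  have h := congrFun (LinearMap.mem_ker.1 hy) ⟨T, hTI⟩
  simp only [M, Pi.zero_apply] at h
  rw [← h]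
  exact Finset.sum_congr rfl fun i _ => mul_comm _ _

lemma shift (d n m : ℕ) (P : Fin n → Fin m → ZMod 2) (y : Fin m → ZMod 2) (z : Fin n → ZMod 2)
    (hy : ∀ T : Finset (Fin n), T.card ≤ d → ∑ i, y i * ∏ a ∈ T, P a i = 0)
    (S : Finset (Fin n)) (hS : S.card ≤ d + 1) :
    ∑ i, ∏ a ∈ S, (z a * y i + P a i) = ∑ i, ∏ a ∈ S, P a i := by
  classical
  simp_rw [Finset.prod_add]
  rw [Finset.sum_comm, Finset.sum_eq_single ∅]
  · simp
  · intro t ht hne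
    have hc : t.card ≠ 0 := by simpa using hne
    have hts := Finset.mem_powerset.1 ht
    have hcard := Finset.card_sdiff_add_card_eq_card hts
    have := hy (S \ t) (by omega)
    calc _ = (∏ a ∈ t, z a) * ∑ i, y i * ∏ a ∈ S \ t, P a i := by
          rw [Finset.mul_sum]
          refine Finset.sum_congr rfl fun i _ => ?_
          rw [Finset.prod_mul_distrib, Finset.prod_const, zmod2_pow _ _ hc, mul_assoc]
      _ = 0 := by rw [this, mul_zero]
  · simp

lemma reduce (d n : ℕ) (m : ℕ) : ∀ (P : Fin n → Fin m → ZMod 2),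
    ∃ m' : ℕ, m' ≤ ∑ i ∈ Finset.range (d + 1), n.choose i ∧
      ∃ P' : Fin n → Fin m' → ZMod 2, ∀ S : Finset (Fin n), S.Nonempty → S.card ≤ d + 1 →
        ∑ i, ∏ a ∈ S, P' a i = ∑ i, ∏ a ∈ S, P a i := by
  induction m with
  | zero => exact fun P => ⟨0, by omega, P, fun _ _ _ => rfl⟩
  | succ m ih =>
    intro P
    by_cases hm : m + 1 ≤ ∑ i ∈ Finset.range (d + 1), n.choose i
    · exact ⟨m + 1, hm, P, fun _ _ _ => rfl⟩
    obtain ⟨y, hy0, hy⟩ := exists_y d n (m + 1) P (by omega)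
    obtain ⟨b, hb⟩ := Function.ne_iff.1 hy0
    have hb1 : y b = 1 := by
      have h : ∀ y : ZMod 2, y ≠ 0 → y = 1 := by decide
      exact h _ hb
    obtain ⟨m', hm', P', hP'⟩ := ih (fun a i => P a b * y (b.succAbove i) + P a (b.succAbove i))
    refine ⟨m', hm', P', fun S hne hS => ?_⟩
    rw [hP' S hne hS, ← shift d n (m + 1) P y (fun a => P a b) hy S hS,
      Fin.sum_univ_succAbove _ b]
    obtain ⟨a, ha⟩ := hne
    rw [Finset.prod_eq_zero ha, zero_add]
    rw [hb1, mul_one]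
    exact CharTwo.add_self_eq_zero _

lemma card_cast (d n m : ℕ) (P : Fin n → Fin m → Bool) (Q : Fin n → Fin m → ZMod 2)
    (h : ∀ a i, Q a i = if P a i = true then 1 else 0) (α : Fin (d + 1) → Fin n) :
    ((Finset.univ.filter (fun i => ∀ j, P (α j) i = true)).card : ZMod 2) =
      ∑ i, ∏ a ∈ Finset.univ.image α, Q a i := by
  rw [Finset.card_filter, Nat.cast_sum]
  refine Finset.sum_congr rfl fun i _ => ?_
  simp_rw [h]
  rw [Finset.prod_ite_zero]
  simp

theorem stmt_12 (d n m : ℕ) (P : Fin n → Fin m → Bool) :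
    ∃ m' : ℕ, m' ≤ ∑ i ∈ Finset.range (d + 1), n.choose i ∧
      ∃ P' : Fin n → Fin m' → Bool,
        ∀ α : Fin (d + 1) → Fin n, Monotone α →
          (Finset.univ.filter (fun i => ∀ j, P' (α j) i = true)).card % 2 =
          (Finset.univ.filter (fun i => ∀ j, P (α j) i = true)).card % 2 := by
  obtain ⟨m', hm', Q', hQ'⟩ := reduce d n m (fun a i => if P a i = true then 1 else 0)
  refine ⟨m', hm', fun a i => decide (Q' a i = 1), fun α _ => ?_⟩
  apply (ZMod.natCast_eq_natCast_iff' _ _ 2).1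
  rw [card_cast d n m P _ (fun _ _ => rfl), card_cast d n m' (fun a i => decide (Q' a i = 1)) Q']
  · apply hQ' _ (by simp)
    exact Finset.card_image_le.trans (by simp)
  · intro a i
    have h : ∀ y : ZMod 2, y = if decide (y = 1) = true then 1 else 0 := by decide
    exact h _
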